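/- Let c > 0 be a constant such that c·∫₀^∞|u|² ≤ ∫₀^∞|u'|² + ∫₀^∞ x^β|u|² for every continuously differentiable u : [0,∞) → ℂ with u, u' square-integrable. Then there exists a function Ψ : ℂ → ℂ that is complex-differentiable (holomorphic) on the open disc {η ∈ ℂ : |η| < c}, such that for every η in this disc and every twice continuously differentiable F : [0,∞) → ℂ with F, F', F'' square-integrable on (0,∞), F'(0) = 1, and −F''(x) + i x^β F(x) − η F(x) = 0 for all x ≥ 0, one has F(0) = Ψ(η). -/

import Mathlib

open MeasureTheory Set
open Filter Topology Interval

/-- The integral of a jointly continuous family that is entire in the parameter is entire. -/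
lemma differentiable_intervalIntegral_of_entire {f : ℂ → ℝ → ℂ} (hc : Continuous f.uncurry)
    (hd : ∀ t, Differentiable ℂ fun z => f z t) (y : ℝ) :
    Differentiable ℂ fun z => ∫ t in (0:ℝ)..y, f z t := by
  intro z₀
  obtain ⟨C, hC⟩ := ((isCompact_closedBall z₀ 2).prod (isCompact_uIcc (a := (0:ℝ)) (b := y))
    ).exists_bound_of_continuousOn hc.continuousOn
  have hz : ∀ z, Continuous (f z) := fun z => hc.comp (by fun_prop : Continuous fun t => (z, t))
  refine (intervalIntegral.hasDerivAt_integral_of_dominated_loc_of_deriv_le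
    (F := f) (F' := fun z t => deriv (fun z => f z t) z) (bound := fun _ => C)
    (s := Metric.ball z₀ 1) (Metric.ball_mem_nhds z₀ one_pos)
    (Eventually.of_forall fun z => (hz z).aestronglyMeasurable)
    ((hz z₀).intervalIntegrable _ _) ?_ ?_ (by simp) ?_).2.differentiableAt
  · have hc' : Continuous (fun (t : ℝ) (z : ℂ) => f z t).uncurry := hc.comp continuous_swap
    exact ((stronglyMeasurable_deriv_with_param hc').comp_measurable
      (measurable_id.prodMk measurable_const)).aestronglyMeasurable
  · refine Eventually.of_forall fun t ht z hz' => ?_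
    have := Complex.norm_deriv_le_of_forall_mem_sphere_norm_le (c := z) (R := 1) (C := C)
      (f := fun z => f z t) one_pos (hd t).diffContOnCl fun w hw =>
      hC (w, t) ⟨?_, uIoc_subset_uIcc ht⟩
    · simpa using this
    · have h1 : dist w z = 1 := hw
      have h2 : dist z z₀ < 1 := hz'
      exact Metric.mem_closedBall.2 ((dist_triangle w z z₀).trans (by linarith))
  · exact Eventually.of_forall fun t _ z _ => (hd t z).hasDerivAt

/-- Picard iterates for the system `u' = v`, `v' = q u` with `u 0 = A`, `v 0 = B`. -/
noncomputable def picardIterate (q : ℂ → ℝ → ℂ) (A B : ℂ) : ℕ → ℂ → ℝ → ℂ × ℂ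
  | 0 => fun _ _ => (A, B)
  | n + 1 => fun z y => (∫ t in (0:ℝ)..y, (picardIterate q A B n z t).2,
      ∫ t in (0:ℝ)..y, q z t * (picardIterate q A B n z t).1)

section Picard

variable {q : ℂ → ℝ → ℂ} (A B : ℂ)

lemma continuous_picardIterate (hq : Continuous q.uncurry) (n : ℕ) :
    Continuous (picardIterate q A B n).uncurry := by
  induction n with
  | zero => exact continuous_const
  | succ n ih =>
    refine Continuous.prodMk ?_ ?_
    · exact intervalIntegral.continuous_parametric_intervalIntegral_of_continuous
        (f := fun (p : ℂ × ℝ) t => (picardIterate q A B n p.1 t).2)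
        (continuous_snd.comp
          (ih.comp (by fun_prop : Continuous fun p : (ℂ × ℝ) × ℝ => (p.1.1, p.2))))
        continuous_snd
    · refine intervalIntegral.continuous_parametric_intervalIntegral_of_continuous
        (f := fun (p : ℂ × ℝ) t => q p.1 t * (picardIterate q A B n p.1 t).1) ?_
        continuous_snd
      have h : Continuous fun p : (ℂ × ℝ) × ℝ => (p.1.1, p.2) := by fun_prop
      exact (hq.comp h).mul (continuous_fst.comp (ih.comp h))

lemma differentiable_picardIterate (hq : Continuous q.uncurry)
    (hd : ∀ t, Differentiable ℂ fun z => q z t) (n : ℕ) (y : ℝ) :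
    Differentiable ℂ fun z => picardIterate q A B n z y := by
  induction n generalizing y with
  | zero => exact differentiable_const _
  | succ n ih =>
    have hc := continuous_picardIterate A B hq n
    refine Differentiable.prodMk ?_ ?_
    · exact differentiable_intervalIntegral_of_entire
        (f := fun z t => (picardIterate q A B n z t).2) (continuous_snd.comp hc)
        (fun t => differentiable_snd.comp (ih t)) y
    · exact differentiable_intervalIntegral_of_entire
        (f := fun z t => q z t * (picardIterate q A B n z t).1) (hq.mul (continuous_fst.comp hc))
        (fun t => (hd t).mul (differentiable_fst.comp (ih t))) y

lemma hasDerivAt_picardIterate_succ (hq : Continuous q.uncurry) (n : ℕ) (z : ℂ) (y : ℝ) :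
    HasDerivAt (fun y => (picardIterate q A B (n + 1) z y).1) (picardIterate q A B n z y).2 y ∧
    HasDerivAt (fun y => (picardIterate q A B (n + 1) z y).2)
      (q z y * (picardIterate q A B n z y).1) y := by
  have h : Continuous fun t : ℝ => (z, t) := by fun_prop
  have hc : Continuous (picardIterate q A B n z) := (continuous_picardIterate A B hq n).comp h
  have hqz : Continuous (q z) := hq.comp h
  exact ⟨intervalIntegral.integral_hasDerivAt_right
      ((continuous_snd.comp hc).intervalIntegrable _ _)
      (continuous_snd.comp hc).aestronglyMeasurable.stronglyMeasurableAtFilter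
      (continuous_snd.comp hc).continuousAt,
    intervalIntegral.integral_hasDerivAt_right
      ((hqz.mul (continuous_fst.comp hc)).intervalIntegrable _ _)
      (hqz.mul (continuous_fst.comp hc)).aestronglyMeasurable.stronglyMeasurableAtFilter
      (hqz.mul (continuous_fst.comp hc)).continuousAt⟩

/-- Factorial bound for one integration step. -/
lemma norm_integral_le_pow_div_factorial {g : ℝ → ℂ} {K C : ℝ} {n : ℕ} {y Y : ℝ}
    (hy : |y| < Y)
    (hg : ∀ t, |t| < Y → ‖g t‖ ≤ C * (K * (C * |t|) ^ n / n.factorial)) :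
    ‖∫ t in (0:ℝ)..y, g t‖ ≤ K * (C * |y|) ^ (n + 1) / (n + 1).factorial := by
  have h1 : ‖∫ t in (0:ℝ)..y, g t‖ ≤
      ∫ t in Ι 0 y, (K * C ^ (n + 1) / n.factorial) * |t - 0| ^ n := by
    rw [intervalIntegral.norm_intervalIntegral_eq]
    refine norm_integral_le_of_norm_le ?_ ?_
    · exact (Continuous.intervalIntegrable (by fun_prop) 0 y).def'
    · refine (ae_restrict_iff' measurableSet_uIoc).2 (Eventually.of_forall fun t ht => ?_)
      have ht' : |t| ≤ |y| := by
        rcases le_total 0 y with h | h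
        · rw [uIoc_of_le h] at ht
          rw [abs_of_nonneg h, abs_of_pos ht.1]; exact ht.2
        · rw [uIoc_of_ge h] at ht
          rw [abs_of_nonpos h, abs_of_nonpos ht.2]; linarith [ht.1]
      refine (hg t (ht'.trans_lt hy)).trans_eq ?_
      rw [sub_zero, mul_pow]; ring
  refine h1.trans_eq ?_
  rw [integral_const_mul, integral_pow_abs_sub_uIoc, sub_zero, Nat.factorial_succ, mul_pow]
  push_cast
  have : (n.factorial : ℝ) ≠ 0 := by positivity
  field_simp

lemma norm_picardIterate_le {K C Y : ℝ} {z : ℂ} (hA : ‖A‖ ≤ K) (hB : ‖B‖ ≤ K) (hC : 1 ≤ C)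
    (hqC : ∀ t, |t| < Y → ‖q z t‖ ≤ C) (n : ℕ) (y : ℝ) (hy : |y| < Y) :
    ‖picardIterate q A B n z y‖ ≤ K * (C * |y|) ^ n / n.factorial := by
  have hK : 0 ≤ K := (norm_nonneg A).trans hA
  induction n generalizing y with
  | zero => simpa [picardIterate] using ⟨hA, hB⟩
  | succ n ih =>
    refine norm_prod_le_iff.2 ⟨?_, ?_⟩
    · refine norm_integral_le_pow_div_factorial hy fun t ht => ?_
      have h0 : 0 ≤ K * (C * |t|) ^ n / n.factorial := by positivity
      exact ((norm_snd_le _).trans (ih t ht)).trans (by nlinarith)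
    · refine norm_integral_le_pow_div_factorial hy fun t ht => ?_
      rw [norm_mul]
      exact mul_le_mul (hqC t ht) ((norm_fst_le _).trans (ih t ht)) (norm_nonneg _) (by linarith)

/-- Solutions of `u'' = q u` with fixed initial data depend holomorphically on a parameter
in which `q` is entire. -/
theorem exists_entire_family_of_solutions (hq : Continuous q.uncurry)
    (hd : ∀ t, Differentiable ℂ fun z => q z t) :
    ∃ u v : ℂ → ℝ → ℂ, (∀ z, u z 0 = A) ∧ (∀ z, v z 0 = B) ∧
      (∀ z y, HasDerivAt (u z) (v z y) y) ∧ (∀ z y, HasDerivAt (v z) (q z y * u z y) y) ∧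
      (∀ y, Differentiable ℂ fun z => u z y) ∧ (∀ y, Differentiable ℂ fun z => v z y) := by
  set P := picardIterate q A B with hP
  have hP0 : ∀ n z, P (n + 1) z 0 = 0 := by
    intro n z; simp [hP, picardIterate]
  have key : ∀ r Y : ℝ, ∃ s : ℕ → ℝ, ∃ C : ℝ, Summable s ∧ 1 ≤ C ∧
      (∀ z y, ‖z‖ < r → |y| < Y → ‖q z y‖ ≤ C) ∧
      ∀ n z y, ‖z‖ < r → |y| < Y → ‖P n z y‖ ≤ s n := by
    intro r Y
    obtain ⟨C, hC⟩ := ((isCompact_closedBall (0:ℂ) r).prod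
      (isCompact_closedBall (0:ℝ) Y)).exists_bound_of_continuousOn hq.continuousOn
    have hC' : ∀ z y, ‖z‖ < r → |y| < Y → ‖q z y‖ ≤ max C 1 := fun z y hz hy =>
      (hC (z, y) ⟨by simpa using hz.le, by simpa using hy.le⟩).trans (le_max_left _ _)
    refine ⟨fun n => max ‖A‖ ‖B‖ * ((max C 1 * Y) ^ n / n.factorial), max C 1,
      (Real.summable_pow_div_factorial _).mul_left _, le_max_right _ _, hC', fun n z y hz hy => ?_⟩
    refine (norm_picardIterate_le A B (le_max_left _ _) (le_max_right _ _) (le_max_right C 1)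
      (fun t ht => hC' z t hz ht) n y hy).trans ?_
    rw [mul_div_assoc]
    beta_reduce
    gcongr
  have hsum : ∀ z y, Summable fun n => P n z y := by
    intro z y
    obtain ⟨s, C, hs, -, -, h⟩ := key (‖z‖ + 1) (|y| + 1)
    exact Summable.of_norm_bounded hs fun n => h n z y (by linarith) (by linarith)
  have hdiff : ∀ y, Differentiable ℂ fun z => ∑' n, P n z y := by
    intro y z
    obtain ⟨s, C, hs, -, -, h⟩ := key (‖z‖ + 1) (|y| + 1)
    refine (Complex.differentiableOn_tsum_of_summable_norm hs
      (fun n => (differentiable_picardIterate A B hq hd n y).differentiableOn)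
      (Metric.isOpen_ball (x := (0:ℂ)) (ε := ‖z‖ + 1)) fun n w hw =>
        h n w y (by simpa using hw) (by linarith)).differentiableAt
      (Metric.isOpen_ball.mem_nhds (by simp))
  have hfst : ∀ z y, (∑' n, P n z y).1 = ∑' n, (P n z y).1 := fun z y =>
    (ContinuousLinearMap.fst ℂ ℂ ℂ).map_tsum (hsum z y)
  have hsnd : ∀ z y, (∑' n, P n z y).2 = ∑' n, (P n z y).2 := fun z y =>
    (ContinuousLinearMap.snd ℂ ℂ ℂ).map_tsum (hsum z y)
  have hs1 : ∀ z y, Summable fun n => (P n z y).1 := fun z y =>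
    (ContinuousLinearMap.fst ℂ ℂ ℂ).summable (hsum z y)
  have hs2 : ∀ z y, Summable fun n => (P n z y).2 := fun z y =>
    (ContinuousLinearMap.snd ℂ ℂ ℂ).summable (hsum z y)
  have h0 : ∀ z, ∑' n, P n z 0 = (A, B) := by
    intro z
    rw [tsum_eq_single 0 fun n hn => ?_]
    · rfl
    · obtain ⟨m, rfl⟩ := Nat.exists_eq_succ_of_ne_zero hn
      exact hP0 m z
  refine ⟨fun z y => (∑' n, P n z y).1, fun z y => (∑' n, P n z y).2, fun z => by simp only [h0],
    fun z => by simp only [h0], fun z y => ?_, fun z y => ?_,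
    fun y => differentiable_fst.comp (hdiff y), fun y => differentiable_snd.comp (hdiff y)⟩
  · obtain ⟨s, C, hs, -, -, h⟩ := key (‖z‖ + 1) (|y| + 1)
    have hfun : (fun y => (∑' n, P n z y).1) = fun y => A + ∑' n, (P (n + 1) z y).1 := by
      funext x
      rw [hfst, (hs1 z x).tsum_eq_zero_add]; rfl
    beta_reduce
    rw [hfun, hsnd]
    refine (hasDerivAt_tsum_of_isPreconnected hs Metric.isOpen_ball
      (convex_ball (0:ℝ) (|y| + 1)).isPreconnected
      (fun n x _ => (hasDerivAt_picardIterate_succ A B hq n z x).1)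
      (fun n x hx => (norm_snd_le _).trans (h n z x (by linarith) (by simpa using hx)))
      (y₀ := 0) (by simp; positivity) ?_ (by simp)).const_add A
    exact (summable_nat_add_iff (f := fun n => (P n z 0).1) 1).2 (hs1 z 0)
  · obtain ⟨s, C, hs, hC1, hC, h⟩ := key (‖z‖ + 1) (|y| + 1)
    have hfun : (fun y => (∑' n, P n z y).2) = fun y => B + ∑' n, (P (n + 1) z y).2 := by
      funext x
      rw [hsnd, (hs2 z x).tsum_eq_zero_add]; rfl
    beta_reduce
    rw [hfun, hfst, ← tsum_mul_left]
    refine (hasDerivAt_tsum_of_isPreconnected (hs.mul_left C) Metric.isOpen_ball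
      (convex_ball (0:ℝ) (|y| + 1)).isPreconnected
      (fun n x _ => (hasDerivAt_picardIterate_succ A B hq n z x).2)
      (fun n x hx => ?_)
      (y₀ := 0) (by simp; positivity) ?_ (by simp)).const_add B
    · have hx' : |x| < |y| + 1 := by simpa using hx
      rw [norm_mul]
      exact mul_le_mul (hC z x (by linarith) hx')
        ((norm_fst_le _).trans (h n z x (by linarith) hx')) (norm_nonneg _) (by linarith)
    · exact (summable_nat_add_iff (f := fun n => (P n z 0).2) 1).2 (hs2 z 0)

end Picard

/-- `w` with derivative `v` solves `w'' = q w` on the open half line `(0,∞)`. -/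
def IsSolution (q w v : ℝ → ℂ) : Prop :=
  ∀ y, 0 < y → HasDerivAt w (v y) y ∧ HasDerivAt v (q y * w y) y

/-- The `H¹` energy of `w` (with derivative `v`) on `[R, X]`. -/
noncomputable def energy (w v : ℝ → ℂ) (R X : ℝ) : ℝ :=
  ∫ y in R..X, (‖w y‖ ^ 2 + ‖v y‖ ^ 2)

namespace IsSolution

variable {q w v w₁ v₁ : ℝ → ℂ} {R X Y : ℝ}

lemma continuousOn_fst (h : IsSolution q w v) : ContinuousOn w (Ioi 0) := fun y hy =>
  (h y hy).1.continuousAt.continuousWithinAt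

lemma continuousOn_snd (h : IsSolution q w v) : ContinuousOn v (Ioi 0) := fun y hy =>
  (h y hy).2.continuousAt.continuousWithinAt

lemma continuousOn_density (h : IsSolution q w v) :
    ContinuousOn (fun y => ‖w y‖ ^ 2 + ‖v y‖ ^ 2) (Ioi 0) :=
  (h.continuousOn_fst.norm.pow 2).add (h.continuousOn_snd.norm.pow 2)

lemma intervalIntegrable_density (h : IsSolution q w v) (hX : 0 < X) (hY : 0 < Y) :
    IntervalIntegrable (fun y => ‖w y‖ ^ 2 + ‖v y‖ ^ 2) volume X Y :=
  (h.continuousOn_density.mono fun _ ht => (lt_min hX hY).trans_le ht.1).intervalIntegrable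

lemma add (h : IsSolution q w v) (h₁ : IsSolution q w₁ v₁) :
    IsSolution q (fun y => w y + w₁ y) (fun y => v y + v₁ y) := fun y hy =>
  ⟨(h y hy).1.add (h₁ y hy).1, by rw [mul_add]; exact (h y hy).2.add (h₁ y hy).2⟩

lemma const_mul (h : IsSolution q w v) (a : ℂ) :
    IsSolution q (fun y => a * w y) (fun y => a * v y) := fun y hy =>
  ⟨(h y hy).1.const_mul a, by simpa only [mul_left_comm] using (h y hy).2.const_mul a⟩

lemma sub (h : IsSolution q w v) (h₁ : IsSolution q w₁ v₁) :
    IsSolution q (fun y => w y - w₁ y) (fun y => v y - v₁ y) := fun y hy =>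
  ⟨(h y hy).1.sub (h₁ y hy).1, by rw [mul_sub]; exact (h y hy).2.sub (h₁ y hy).2⟩

lemma energy_nonneg (w v : ℝ → ℂ) (hX : R ≤ X) : 0 ≤ energy w v R X :=
  intervalIntegral.integral_nonneg hX fun _ _ => by positivity

lemma energy_add_adjacent (h : IsSolution q w v) (hR : 0 < R) (hX : 0 < X) (hY : 0 < Y) :
    energy w v R X + energy w v X Y = energy w v R Y :=
  intervalIntegral.integral_add_adjacent_intervals (h.intervalIntegrable_density hR hX)
    (h.intervalIntegrable_density hX hY)

lemma energy_mono (h : IsSolution q w v) (hR : 0 < R) (hX : R ≤ X) (hY : X ≤ Y) :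
    energy w v R X ≤ energy w v R Y := by
  rw [← h.energy_add_adjacent hR (hR.trans_le hX) ((hR.trans_le hX).trans_le hY)]
  linarith [energy_nonneg w v hY]

lemma energy_const_mul (w v : ℝ → ℂ) (a : ℂ) (R X : ℝ) :
    energy (fun y => a * w y) (fun y => a * v y) R X = ‖a‖ ^ 2 * energy w v R X := by
  simp only [energy, norm_mul, mul_pow, ← mul_add, intervalIntegral.integral_const_mul]

lemma norm_sub_sq_le (x y : ℂ) : ‖x - y‖ ^ 2 ≤ 2 * (‖x‖ ^ 2 + ‖y‖ ^ 2) := by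
  have h := norm_sub_le x y
  nlinarith [norm_nonneg (x - y), sq_nonneg (‖x‖ - ‖y‖), norm_nonneg x, norm_nonneg y]

lemma energy_sub_le (h : IsSolution q w v) (h₁ : IsSolution q w₁ v₁) (hR : 0 < R) (hX : R ≤ X) :
    energy (fun y => w y - w₁ y) (fun y => v y - v₁ y) R X ≤
      2 * (energy w v R X + energy w₁ v₁ R X) := by
  have hX' := hR.trans_le hX
  have i := h.intervalIntegrable_density hR hX'
  have i₁ := h₁.intervalIntegrable_density hR hX'
  rw [energy, energy, energy, ← intervalIntegral.integral_add i i₁,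
    ← intervalIntegral.integral_const_mul]
  refine intervalIntegral.integral_mono_on hX ((h.sub h₁).intervalIntegrable_density hR hX')
    ((i.add i₁).const_mul 2) fun y _ => ?_
  linarith [norm_sub_sq_le (w y) (w₁ y), norm_sub_sq_le (v y) (v₁ y)]

/-- The boundary form whose derivative dominates the energy density. -/
noncomputable def boundaryForm (w v : ℝ → ℂ) (y : ℝ) : ℝ :=
  ((1 - Complex.I) * (starRingEnd ℂ (w y) * v y)).re

lemma abs_boundaryForm_le (w v : ℝ → ℂ) (y : ℝ) : |boundaryForm w v y| ≤ 2 * ‖w y‖ * ‖v y‖ := by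
  refine (Complex.abs_re_le_norm _).trans ?_
  rw [norm_mul, norm_mul, RCLike.norm_conj, mul_assoc]
  have : ‖(1:ℂ) - Complex.I‖ ≤ 2 := (norm_sub_le _ _).trans (by norm_num)
  gcongr

lemma hasDerivAt_conj_mul (h : IsSolution q w v) {y : ℝ} (hy : 0 < y) :
    HasDerivAt (fun y => starRingEnd ℂ (w y) * v y)
      (((‖v y‖ ^ 2 : ℝ) : ℂ) + q y * ((‖w y‖ ^ 2 : ℝ) : ℂ)) y := by
  have h1 : HasDerivAt (fun y => starRingEnd ℂ (w y)) (starRingEnd ℂ (v y)) y :=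
    (h y hy).1.star
  convert! h1.mul (h y hy).2 using 1
  rw [mul_left_comm]
  push_cast
  rw [← Complex.conj_mul', ← Complex.conj_mul']

lemma hasDerivAt_boundaryForm (h : IsSolution q w v) {y : ℝ} (hy : 0 < y) :
    HasDerivAt (boundaryForm w v)
      (‖v y‖ ^ 2 + ((1 - Complex.I) * q y).re * ‖w y‖ ^ 2) y := by
  have h1 := ((h.hasDerivAt_conj_mul hy).const_mul (1 - Complex.I))
  have h2 := Complex.reCLM.hasFDerivAt.comp_hasDerivAt y h1
  convert! h2 using 1
  rw [mul_add, ← mul_assoc]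
  simp only [Complex.reCLM_apply, Complex.add_re, Complex.re_mul_ofReal]
  simp

lemma energy_le_boundaryForm_sub (h : IsSolution q w v) (hR : 0 < R) (hX : R ≤ X)
    (hq : ∀ y, R ≤ y → 1 ≤ ((1 - Complex.I) * q y).re) :
    energy w v R X ≤ boundaryForm w v X - boundaryForm w v R := by
  have hp : ∀ y ∈ Icc R X, 0 < y := fun y hy => hR.trans_le hy.1
  refine intervalIntegral.integral_le_sub_of_hasDeriv_right_of_le hX
    (fun y hy => (h.hasDerivAt_boundaryForm (hp y hy)).continuousAt.continuousWithinAt)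
    (fun y hy => (h.hasDerivAt_boundaryForm (hp y (Ioo_subset_Icc_self hy))).hasDerivWithinAt)
    (h.continuousOn_density.mono hp).integrableOn_Icc fun y hy => ?_
  nlinarith [hq y hy.1.le, sq_nonneg ‖w y‖]

/-- Trace inequality. -/
lemma norm_sq_le_energy (h : IsSolution q w v) (hR : 0 < R) (hX : R + 1 ≤ X) :
    ‖w R‖ ^ 2 ≤ 2 * energy w v R X := by
  suffices ‖w R‖ ^ 2 ≤ 2 * energy w v R (R + 1) by
    linarith [h.energy_mono hR (by linarith) hX]
  have hpt : ∀ y ∈ Icc R (R + 1), ‖w R‖ ^ 2 ≤ ‖w y‖ ^ 2 + ‖v y‖ ^ 2 + energy w v R (R + 1) := by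
    intro y hy
    have hp : ∀ t ∈ Icc R y, 0 < t := fun t ht => hR.trans_le ht.1
    have hd : ∀ t ∈ Icc R y, HasDerivAt (fun t => -‖w t‖ ^ 2) (-(2 * inner ℝ (w t) (v t))) t :=
      fun t ht => (h t (hp t ht)).1.norm_sq.neg
    have := intervalIntegral.sub_le_integral_of_hasDeriv_right_of_le hy.1
      (fun t ht => (hd t ht).continuousAt.continuousWithinAt)
      (fun t ht => (hd t (Ioo_subset_Icc_self ht)).hasDerivWithinAt)
      (h.continuousOn_density.mono hp).integrableOn_Icc fun t _ => by
        have := (abs_le.1 (abs_real_inner_le_norm (w t) (v t))).1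
        nlinarith [sq_nonneg (‖w t‖ - ‖v t‖)]
    have h2 := h.energy_mono hR hy.1 hy.2
    rw [energy] at h2
    nlinarith [sq_nonneg ‖v y‖]
  have hi := h.intervalIntegrable_density hR (by linarith : 0 < R + 1)
  have := intervalIntegral.integral_mono_on (by linarith : R ≤ R + 1)
    (intervalIntegrable_const (c := ‖w R‖ ^ 2)) (hi.add (intervalIntegrable_const
      (c := energy w v R (R + 1)))) hpt
  rw [intervalIntegral.integral_add hi intervalIntegrable_const] at this
  simp only [intervalIntegral.integral_const, add_sub_cancel_left, one_smul] at this
  change _ ≤ energy w v R (R + 1) + _ at this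
  linarith

/-- A solution with Neumann condition at `R` has linearly growing energy. -/
lemma mul_norm_sq_le_energy (h : IsSolution q w v) (hR : 0 < R) (hX : R + 1 ≤ X)
    (hq : ∀ y, R ≤ y → 1 ≤ ((1 - Complex.I) * q y).re) (hv : v R = 0) :
    (X - R - 1) * ‖w R‖ ^ 2 ≤ 2 * energy w v R X := by
  have hR1 : 0 < R + 1 := by linarith
  have hX0 : 0 < X := by linarith
  have hJ : boundaryForm w v R = 0 := by simp [boundaryForm, hv]
  have hpt : ∀ y ∈ Icc (R + 1) X, ‖w R‖ ^ 2 / 2 ≤ ‖w y‖ ^ 2 + ‖v y‖ ^ 2 := by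
    intro y hy
    have h1 := h.norm_sq_le_energy hR hy.1
    have h2 := h.energy_le_boundaryForm_sub hR (by linarith [hy.1] : R ≤ y) hq
    have h3 := (abs_le.1 (abs_boundaryForm_le w v y)).2
    nlinarith [sq_nonneg (‖w y‖ - ‖v y‖)]
  have := intervalIntegral.integral_mono_on hX
    (intervalIntegrable_const (c := ‖w R‖ ^ 2 / 2)) (h.intervalIntegrable_density hR1 hX0) hpt
  rw [intervalIntegral.integral_const, smul_eq_mul] at this
  change _ ≤ energy w v (R + 1) X at this
  have h4 := h.energy_add_adjacent hR hR1 hX0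
  have h5 := energy_nonneg w v (by linarith : R ≤ R + 1)
  linarith

/-- Energy bound for solutions with Dirichlet condition at `X`. -/
lemma energy_le_of_eq_zero (h : IsSolution q w v) (hR : 0 < R) (hX : R + 1 ≤ X)
    (hq : ∀ y, R ≤ y → 1 ≤ ((1 - Complex.I) * q y).re) (hw : w X = 0) :
    energy w v R X ≤ 8 * ‖v R‖ ^ 2 := by
  have hJ : boundaryForm w v X = 0 := by simp [boundaryForm, hw]
  have h1 := h.norm_sq_le_energy hR hX
  have h2 := h.energy_le_boundaryForm_sub hR (by linarith : R ≤ X) hq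
  have h3 := (abs_le.1 (abs_boundaryForm_le w v R)).1
  have ha := norm_nonneg (w R)
  have hb := norm_nonneg (v R)
  have h4 : ‖w R‖ ≤ 4 * ‖v R‖ := by
    by_contra! hlt
    nlinarith
  nlinarith

lemma hasDerivAt_wronskian (h : IsSolution q w v) (h₁ : IsSolution q w₁ v₁) {y : ℝ} (hy : 0 < y) :
    HasDerivAt (fun y => w y * v₁ y - v y * w₁ y) 0 y := by
  convert! ((h y hy).1.mul (h₁ y hy).2).sub ((h y hy).2.mul (h₁ y hy).1) using 1
  ring

/-- The Wronskian of two solutions is constant. -/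
lemma wronskian_eq (h : IsSolution q w v) (h₁ : IsSolution q w₁ v₁) (hR : 0 ≤ R)
    (hw : ContinuousOn w (Ici R)) (hv : ContinuousOn v (Ici R))
    (hw₁ : ContinuousOn w₁ (Ici R)) (hv₁ : ContinuousOn v₁ (Ici R)) {y : ℝ} (hy : R ≤ y) :
    w y * v₁ y - v y * w₁ y = w R * v₁ R - v R * w₁ R := by
  have := intervalIntegral.integral_eq_sub_of_hasDeriv_right_of_le hy
    (f := fun y => w y * v₁ y - v y * w₁ y) (f' := fun _ => 0)
    (((hw.mul hv₁).sub (hv.mul hw₁)).mono Icc_subset_Ici_self)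
    (fun t ht => (h.hasDerivAt_wronskian h₁ (hR.trans_lt ht.1)).hasDerivWithinAt) (by simp)
  rw [intervalIntegral.integral_zero] at this
  exact sub_eq_zero.1 this.symm

/-- A solution is determined by its Wronskians with a normalized fundamental system. -/
lemma eq_of_wronskian {θ θ' φ φ' : ℝ → ℂ} (h : IsSolution q w v) (hθ : IsSolution q θ θ')
    (hφ : IsSolution q φ φ') (hR : 0 ≤ R) (hw : ContinuousOn w (Ici R))
    (hv : ContinuousOn v (Ici R)) (cθ : ContinuousOn θ (Ici R)) (cθ' : ContinuousOn θ' (Ici R))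
    (cφ : ContinuousOn φ (Ici R)) (cφ' : ContinuousOn φ' (Ici R))
    (hW : ∀ y, R ≤ y → θ y * φ' y - θ' y * φ y = 1) {y : ℝ} (hy : R ≤ y) :
    w y = (w R * φ' R - v R * φ R) * θ y - (w R * θ' R - v R * θ R) * φ y ∧
    v y = (w R * φ' R - v R * φ R) * θ' y - (w R * θ' R - v R * θ R) * φ' y := by
  have h1 := h.wronskian_eq hφ hR hw hv cφ cφ' hy
  have h2 := h.wronskian_eq hθ hR hw hv cθ cθ' hy
  have h3 := hW y hy
  rw [← h1, ← h2]
  exact ⟨by linear_combination -(w y) * h3, by linear_combination -(v y) * h3⟩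

end IsSolution

lemma exists_holomorphic_limit {F : ℕ → ℂ → ℂ} {Ω : Set ℂ} (hΩ : IsOpen Ω) {C : ℝ}
    (hF : ∀ n, DifferentiableOn ℂ (F n) Ω)
    (hC : ∀ z ∈ Ω, ∀ n k : ℕ, n ≤ k → (n + 1 : ℝ) * ‖F k z - F n z‖ ^ 2 ≤ C) :
    ∃ m : ℂ → ℂ, DifferentiableOn ℂ m Ω ∧ ∀ z ∈ Ω, Tendsto (fun n => F n z) atTop (𝓝 (m z)) := by
  have hU : UniformCauchySeqOn F atTop Ω := by
    rw [Metric.uniformCauchySeqOn_iff]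
    intro ε hε
    obtain ⟨N, hN⟩ := exists_nat_gt (4 * C / ε ^ 2)
    have hlt : ∀ z ∈ Ω, ∀ k, N ≤ k → ‖F k z - F N z‖ < ε / 2 := by
      intro z hz k hk
      by_contra! hge
      have h1 := hC z hz N k hk
      have h2 : (ε / 2) ^ 2 ≤ ‖F k z - F N z‖ ^ 2 := by gcongr
      rw [div_lt_iff₀ (by positivity)] at hN
      nlinarith [mul_le_mul_of_nonneg_left h2 (by positivity : (0:ℝ) ≤ N + 1), sq_pos_of_pos hε]
    refine ⟨N, fun j hj k hk z hz => ?_⟩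
    have h1 := hlt z hz j hj
    have h2 := hlt z hz k hk
    rw [← dist_eq_norm] at h1 h2
    linarith [dist_triangle_right (F j z) (F k z) (F N z)]
  have hlim : ∀ z, ∃ l, z ∈ Ω → Tendsto (fun n => F n z) atTop (𝓝 l) := by
    intro z
    by_cases hz : z ∈ Ω
    · obtain ⟨l, hl⟩ := cauchySeq_tendsto_of_complete (hU.cauchySeq hz)
      exact ⟨l, fun _ => hl⟩
    · exact ⟨0, fun h => absurd h hz⟩
  choose m hm using hlim
  exact ⟨m, (hU.tendstoUniformlyOn_of_tendsto hm).tendstoLocallyUniformlyOn.differentiableOn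
    (Eventually.of_forall hF) hΩ, hm⟩

/-- The Weyl function at `R`: finite energy solutions of `w'' = q w` are exactly those with
`w R = m * w' R`, where `m` depends holomorphically on the parameter. -/
theorem exists_weyl_function {q θ θ' φ φ' : ℂ → ℝ → ℂ} {Ω : Set ℂ} (hΩ : IsOpen Ω) {R : ℝ}
    (hR : 0 < R) (hθ : ∀ z, IsSolution (q z) (θ z) (θ' z)) (hφ : ∀ z, IsSolution (q z) (φ z) (φ' z))
    (hW : ∀ z y, 0 ≤ y → θ z y * φ' z y - θ' z y * φ z y = 1)
    (dθ : ∀ y, Differentiable ℂ fun z => θ z y) (dθ' : ∀ y, Differentiable ℂ fun z => θ' z y)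
    (dφ : ∀ y, Differentiable ℂ fun z => φ z y) (dφ' : ∀ y, Differentiable ℂ fun z => φ' z y)
    (hq : ∀ z ∈ Ω, ∀ y, R ≤ y → 1 ≤ ((1 - Complex.I) * q z y).re) :
    ∃ m : ℂ → ℂ, DifferentiableOn ℂ m Ω ∧ ∀ z ∈ Ω, ∀ w v, IsSolution (q z) w v →
      ((∃ C, ∀ X, R ≤ X → energy w v R X ≤ C) ↔ w R = m z * v R) := by
  let X : ℕ → ℝ := fun n => R + 2 + n
  let g : ℕ → ℂ → ℝ → ℂ := fun n z y => φ z (X n) * θ z y - θ z (X n) * φ z y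
  let g' : ℕ → ℂ → ℝ → ℂ := fun n z y => φ z (X n) * θ' z y - θ z (X n) * φ' z y
  have hX1 : ∀ n, R + 1 ≤ X n := fun n => by
    have : (0:ℝ) ≤ n := n.cast_nonneg
    simp only [X]; linarith
  have hX0 : ∀ n, 0 ≤ X n := fun n => by linarith [hX1 n]
  have hg : ∀ n z, IsSolution (q z) (g n z) (g' n z) := fun n z =>
    ((hθ z).const_mul _).sub ((hφ z).const_mul _)
  have hgX : ∀ n z, g n z (X n) = 0 := fun n z => by simp only [g]; ring
  have hne : ∀ n, ∀ z ∈ Ω, g' n z R ≠ 0 := by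
    intro n z hz h0
    have h1 := (hg n z).energy_le_of_eq_zero hR (hX1 n) (hq z hz) (hgX n z)
    have h2 := (hg n z).norm_sq_le_energy hR (hX1 n)
    rw [h0, norm_zero] at h1
    have h3 : g n z R = 0 := by
      rw [← norm_eq_zero]
      nlinarith [norm_nonneg (g n z R)]
    simp only [g] at h3
    simp only [g'] at h0
    have hWR := hW z R hR.le
    have hφ0 : φ z (X n) = 0 := by
      linear_combination -φ z (X n) * hWR + φ' z R * h3 - φ z R * h0
    have hθ0 : θ z (X n) = 0 := by
      linear_combination -θ z (X n) * hWR + θ' z R * h3 - θ z R * h0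
    have := hW z (X n) (hX0 n)
    simp [hφ0, hθ0] at this
  let e : ℕ → ℂ → ℝ → ℂ := fun n z y => (g' n z R)⁻¹ * g n z y
  let e' : ℕ → ℂ → ℝ → ℂ := fun n z y => (g' n z R)⁻¹ * g' n z y
  have he : ∀ n z, IsSolution (q z) (e n z) (e' n z) := fun n z => (hg n z).const_mul _
  have he'R : ∀ n, ∀ z ∈ Ω, e' n z R = 1 := fun n z hz => inv_mul_cancel₀ (hne n z hz)
  have heE : ∀ n, ∀ z ∈ Ω, energy (e n z) (e' n z) R (X n) ≤ 8 := by
    intro n z hz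
    have := (he n z).energy_le_of_eq_zero hR (hX1 n) (hq z hz) (by simp only [e, hgX, mul_zero])
    simpa [he'R n z hz] using this
  have hest : ∀ n : ℕ, ∀ z ∈ Ω, ∀ w v, IsSolution (q z) w v →
      ((n : ℝ) + 1) * ‖w R - v R * e n z R‖ ^ 2 ≤ 4 * (energy w v R (X n) + 8 * ‖v R‖ ^ 2) := by
    intro n z hz w v hw
    have h1 := (hw.sub ((he n z).const_mul (v R))).mul_norm_sq_le_energy hR (hX1 n) (hq z hz)
      (by simp [he'R n z hz])
    have h2 := hw.energy_sub_le ((he n z).const_mul (v R)) hR (by linarith [hX1 n] : R ≤ X n)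
    rw [IsSolution.energy_const_mul] at h2
    have h3 : X n - R - 1 = n + 1 := by simp only [X]; ring
    rw [h3] at h1
    nlinarith [heE n z hz, sq_nonneg ‖v R‖]
  obtain ⟨m, hm, hlim⟩ := exists_holomorphic_limit (F := fun n z => e n z R) hΩ (C := 64)
    (fun n z hz => by
      have d1 : DifferentiableAt ℂ (fun z => g n z R) z :=
        (((dφ _).mul (dθ _)).sub ((dθ _).mul (dφ _))) z
      have d2 : DifferentiableAt ℂ (fun z => g' n z R) z :=
        (((dφ _).mul (dθ' _)).sub ((dθ _).mul (dφ' _))) z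
      exact ((d2.inv (hne n z hz)).mul d1).differentiableWithinAt)
    (fun z hz n k hnk => by
      have h1 := hest n z hz _ _ (he k z)
      have hXX : X n ≤ X k := by simp only [X]; gcongr
      have h2 := (he k z).energy_mono hR (by linarith [hX1 n] : R ≤ X n) hXX
      rw [he'R k z hz] at h1
      simp only [one_mul, norm_one, one_pow, mul_one] at h1
      linarith [heE k z hz])
  have hn : Tendsto (fun n : ℕ => (n + 1 : ℝ)) atTop atTop :=
    tendsto_atTop_add_const_right _ _ tendsto_natCast_atTop_atTop
  refine ⟨m, hm, fun z hz w v hw => ⟨?_, fun hwm => ?_⟩⟩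
  · rintro ⟨C, hC⟩
    have h1 : Tendsto (fun n => ‖w R - v R * e n z R‖ ^ 2) atTop
        (𝓝 (‖w R - v R * m z‖ ^ 2)) :=
      ((((hlim z hz).const_mul _).const_sub _).norm).pow 2
    have h2 : Tendsto (fun n : ℕ => (4 * (C + 8 * ‖v R‖ ^ 2)) / (n + 1 : ℝ)) atTop (𝓝 0) :=
      hn.const_div_atTop _
    have h3 := le_of_tendsto_of_tendsto' h1 h2 fun n => by
      rw [le_div_iff₀' (by positivity)]
      have := hC (X n) (by linarith [hX1 n])
      exact (hest n z hz w v hw).trans (by linarith)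
    have h4 : ‖w R - v R * m z‖ = 0 := by nlinarith [norm_nonneg (w R - v R * m z)]
    rw [norm_eq_zero, sub_eq_zero] at h4
    rw [h4, mul_comm]
  · refine ⟨16 * ‖v R‖ ^ 2, fun Y hY => ?_⟩
    let χ : ℝ → ℂ := fun y => φ' z R * θ z y - θ' z R * φ z y
    let χ' : ℝ → ℂ := fun y => φ' z R * θ' z y - θ' z R * φ' z y
    let ε : ℕ → ℂ := fun n => w R - v R * e n z R
    have hε : Tendsto ε atTop (𝓝 0) := by
      have := ((hlim z hz).const_mul (v R)).const_sub (w R)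
      rwa [hwm, mul_comm (m z), sub_self, ← mul_comm (m z), ← hwm] at this
    have hsub : Ici R ⊆ Ioi 0 := fun y hy => hR.trans_le hy
    have hd : ∀ n, energy (fun y => w y - v R * e n z y) (fun y => v y - v R * e' n z y) R Y =
        ‖ε n‖ ^ 2 * energy χ χ' R Y := by
      intro n
      rw [← IsSolution.energy_const_mul]
      have hs := hw.sub ((he n z).const_mul (v R))
      refine intervalIntegral.integral_congr fun y hy => ?_
      rw [uIcc_of_le hY] at hy
      obtain ⟨h1, h2⟩ := hs.eq_of_wronskian (hθ z) (hφ z) hR.le (hs.continuousOn_fst.mono hsub)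
        (hs.continuousOn_snd.mono hsub) ((hθ z).continuousOn_fst.mono hsub)
        ((hθ z).continuousOn_snd.mono hsub) ((hφ z).continuousOn_fst.mono hsub)
        ((hφ z).continuousOn_snd.mono hsub) (fun y hy => hW z y (hR.le.trans hy)) hy.1
      beta_reduce at h1 h2 ⊢
      rw [h1, h2, he'R n z hz]
      simp only [χ, χ', ε]
      congr 3 <;> ring
    have hle : ∀ᶠ n in atTop, energy w v R Y ≤
        2 * (‖ε n‖ ^ 2 * energy χ χ' R Y + ‖v R‖ ^ 2 * 8) := by
      filter_upwards [hn.eventually_ge_atTop Y] with n hYn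
      have hYX : Y ≤ X n := by simp only [X]; linarith
      have h1 := (hw.sub ((he n z).const_mul (v R))).energy_sub_le
        ((he n z).const_mul (-v R)) hR hY
      rw [hd, IsSolution.energy_const_mul, norm_neg] at h1
      have h2 := ((he n z).energy_mono hR hY hYX).trans (heE n z hz)
      have h3 : energy w v R Y = energy
          (fun y => w y - v R * e n z y - -v R * e n z y)
          (fun y => v y - v R * e' n z y - -v R * e' n z y) R Y := by
        congr 1 <;> funext y <;> ring
      rw [h3]
      refine h1.trans ?_
      gcongr
    have hlim2 : Tendsto (fun n => 2 * (‖ε n‖ ^ 2 * energy χ χ' R Y + ‖v R‖ ^ 2 * 8)) atTop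
        (𝓝 (2 * (‖(0:ℂ)‖ ^ 2 * energy χ χ' R Y + ‖v R‖ ^ 2 * 8))) :=
      ((((hε.norm).pow 2).mul_const _).add_const _).const_mul 2
    refine (ge_of_tendsto hlim2 hle).trans_eq ?_
    simp; ring

/-- A solution of `w'' = q w` on the closed half line, with `w` and `w'` continuous up to `0`. -/
structure IsRegularSolution (q w v : ℝ → ℂ) : Prop where
  isSolution : IsSolution q w v
  continuousOn_fst : ContinuousOn w (Ici 0)
  continuousOn_snd : ContinuousOn v (Ici 0)

/-- `w` and its derivative `v` are square-integrable on `(0,∞)`. -/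
def HasFiniteEnergy (w v : ℝ → ℂ) : Prop :=
  IntegrableOn (fun y => ‖w y‖ ^ 2 + ‖v y‖ ^ 2) (Ioi 0)

lemma IsRegularSolution.hasFiniteEnergy_iff {q w v : ℝ → ℂ} (h : IsRegularSolution q w v) {R : ℝ}
    (hR : 0 < R) : HasFiniteEnergy w v ↔ ∃ C, ∀ X, R ≤ X → energy w v R X ≤ C := by
  have hc : ContinuousOn (fun y => ‖w y‖ ^ 2 + ‖v y‖ ^ 2) (Ici 0) :=
    (h.continuousOn_fst.norm.pow 2).add (h.continuousOn_snd.norm.pow 2)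
  constructor
  · intro hi
    refine ⟨∫ y in Ioi 0, (‖w y‖ ^ 2 + ‖v y‖ ^ 2), fun X hX => ?_⟩
    rw [energy, intervalIntegral.integral_of_le hX]
    exact setIntegral_mono_set hi (Eventually.of_forall fun y => by positivity)
      (Eventually.of_forall fun y hy => hR.trans hy.1)
  · rintro ⟨C, hC⟩
    have h1 : IntegrableOn (fun y => ‖w y‖ ^ 2 + ‖v y‖ ^ 2) (Ioi R) := by
      refine integrableOn_Ioi_of_intervalIntegral_norm_bounded C R (b := id) (l := atTop)
        (fun X => ?_) tendsto_id ?_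
      · exact (hc.mono fun y hy => hR.le.trans hy.1).integrableOn_Icc.mono_set Ioc_subset_Icc_self
      · filter_upwards [eventually_ge_atTop R] with X hX
        refine le_trans (le_of_eq ?_) (hC X hX)
        exact intervalIntegral.integral_congr fun y _ => Real.norm_of_nonneg (by positivity)
    have h2 : IntegrableOn (fun y => ‖w y‖ ^ 2 + ‖v y‖ ^ 2) (Icc 0 R) :=
      (hc.mono Icc_subset_Ici_self).integrableOn_Icc
    refine (h2.union h1).mono_set fun y hy => ?_
    rcases le_or_gt y R with hyR | hyR
    · exact Or.inl ⟨le_of_lt hy, hyR⟩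
    · exact Or.inr hyR

/-- For a family of equations `w'' = q w` depending holomorphically on a parameter, finite energy
is a linear condition on the Cauchy data at `0` with coefficients holomorphic in the parameter. -/
theorem exists_boundary_condition {q : ℂ → ℝ → ℂ} (hc : Continuous q.uncurry)
    (hd : ∀ t, Differentiable ℂ fun z => q z t) {Ω : Set ℂ} (hΩ : IsOpen Ω) {R : ℝ} (hR : 0 < R)
    (hq : ∀ z ∈ Ω, ∀ y, R ≤ y → 1 ≤ ((1 - Complex.I) * q z y).re) :
    (∀ z a b, ∃ w v, IsRegularSolution (q z) w v ∧ w 0 = a ∧ v 0 = b) ∧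
    ∃ D N : ℂ → ℂ, DifferentiableOn ℂ D Ω ∧ DifferentiableOn ℂ N Ω ∧
      ∀ z ∈ Ω, ∀ w v, IsRegularSolution (q z) w v →
        (HasFiniteEnergy w v ↔ w 0 * D z + v 0 * N z = 0) := by
  constructor
  · intro z a b
    obtain ⟨w, v, h1, h2, h3, h4, -, -⟩ := exists_entire_family_of_solutions a b hc hd
    exact ⟨w z, v z, ⟨fun y _ => ⟨h3 z y, h4 z y⟩,
      fun y _ => (h3 z y).continuousAt.continuousWithinAt,
      fun y _ => (h4 z y).continuousAt.continuousWithinAt⟩, h1 z, h2 z⟩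
  obtain ⟨θ, θ', θ0, θ'0, hθ, hθ', dθ, dθ'⟩ := exists_entire_family_of_solutions 1 0 hc hd
  obtain ⟨φ, φ', φ0, φ'0, hφ, hφ', dφ, dφ'⟩ := exists_entire_family_of_solutions 0 1 hc hd
  have sθ : ∀ z, IsSolution (q z) (θ z) (θ' z) := fun z y _ => ⟨hθ z y, hθ' z y⟩
  have sφ : ∀ z, IsSolution (q z) (φ z) (φ' z) := fun z y _ => ⟨hφ z y, hφ' z y⟩
  have cont : ∀ {f g : ℝ → ℂ}, (∀ y, HasDerivAt f (g y) y) → ContinuousOn f (Ici 0) :=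
    fun h y _ => (h y).continuousAt.continuousWithinAt
  have hW : ∀ z y, 0 ≤ y → θ z y * φ' z y - θ' z y * φ z y = 1 := by
    intro z y hy
    rw [(sθ z).wronskian_eq (sφ z) le_rfl (cont (hθ z)) (cont (hθ' z)) (cont (hφ z))
      (cont (hφ' z)) hy, θ0, θ'0, φ0, φ'0]
    ring
  obtain ⟨m, hm, hmw⟩ := exists_weyl_function hΩ hR sθ sφ hW dθ dθ' dφ dφ' hq
  refine ⟨fun z => θ z R - m z * θ' z R, fun z => φ z R - m z * φ' z R,
    (dθ R).differentiableOn.sub (hm.mul (dθ' R).differentiableOn),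
    (dφ R).differentiableOn.sub (hm.mul (dφ' R).differentiableOn), fun z hz w v h => ?_⟩
  rw [h.hasFiniteEnergy_iff hR, hmw z hz w v h.isSolution]
  obtain ⟨h1, h2⟩ := h.isSolution.eq_of_wronskian (sθ z) (sφ z) le_rfl h.continuousOn_fst
    h.continuousOn_snd (cont (hθ z)) (cont (hθ' z)) (cont (hφ z)) (cont (hφ' z)) (hW z) hR.le
  rw [h1, h2, θ0, θ'0, φ0, φ'0, ← sub_eq_zero]
  refine Eq.congr_left ?_
  ring

lemma exists_forall_le_rpow {β : ℝ} (hβ : 0 < β) (M : ℝ) :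
    ∃ R : ℝ, 0 < R ∧ ∀ y, R ≤ y → M ≤ y ^ β := by
  obtain ⟨R, hR⟩ := eventually_atTop.1 ((tendsto_rpow_atTop hβ).eventually_ge_atTop M)
  exact ⟨max R 1, by positivity, fun y hy => hR y ((le_max_left _ _).trans hy)⟩

/-- The coefficient of the equation `w'' = q w` satisfied by `w y = F (exp σ * y)` when
`F'' x = (i x ^ β - η) F x`. -/
noncomputable def dilatedPotential (β : ℝ) (η σ : ℂ) (y : ℝ) : ℂ :=
  Complex.I * Complex.exp ((β + 2) * σ) * ((y ^ β : ℝ) : ℂ) - η * Complex.exp (2 * σ)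

/-- The set of complex dilations for which the dilated potential is coercive at infinity. -/
def dilationStrip (β : ℝ) : Set ℂ :=
  {σ | -1 < σ.re ∧ σ.re < 1 ∧ -(5 * Real.pi / 8) < (β + 2) * σ.im ∧ (β + 2) * σ.im < Real.pi / 8}

lemma isOpen_dilationStrip (β : ℝ) : IsOpen (dilationStrip β) := by
  have h1 : Continuous fun σ : ℂ => (β + 2) * σ.im := by fun_prop
  exact (isOpen_lt continuous_const Complex.continuous_re).inter <|
    (isOpen_lt Complex.continuous_re continuous_const).inter <|
      (isOpen_lt continuous_const h1).inter (isOpen_lt h1 continuous_const)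

lemma convex_dilationStrip (β : ℝ) : Convex ℝ (dilationStrip β) := by
  have h1 : IsLinearMap ℝ fun σ : ℂ => (β + 2) * σ.im :=
    ⟨fun x y => by simp [mul_add], fun a x => by simp; ring⟩
  exact (convex_halfSpace_re_gt (-1)).inter <| (convex_halfSpace_re_lt 1).inter <|
    (convex_halfSpace_gt h1 _).inter (convex_halfSpace_lt h1 _)

lemma continuous_dilatedPotential {β : ℝ} (hβ : 0 ≤ β) (η : ℂ) :
    Continuous (dilatedPotential β η).uncurry := by
  have h : Continuous fun p : ℂ × ℝ => p.2 ^ β :=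
    (Real.continuous_rpow_const hβ).comp continuous_snd
  unfold dilatedPotential Function.uncurry
  fun_prop

lemma differentiable_dilatedPotential (β : ℝ) (η : ℂ) (y : ℝ) :
    Differentiable ℂ fun σ => dilatedPotential β η σ y := by
  unfold dilatedPotential
  fun_prop

lemma abs_re_one_sub_I_mul_le (z : ℂ) : |((1 - Complex.I) * z).re| ≤ 2 * ‖z‖ := by
  refine (Complex.abs_re_le_norm _).trans ?_
  rw [norm_mul]
  have : ‖(1:ℂ) - Complex.I‖ ≤ 2 := (norm_sub_le _ _).trans (by norm_num)
  gcongr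

lemma cos_le_cos_sub_sin {x : ℝ} (h1 : -(5 * Real.pi / 8) < x) (h2 : x < Real.pi / 8) :
    Real.cos (3 * Real.pi / 8) ≤ Real.cos x - Real.sin x := by
  have hpi := Real.pi_pos
  have hk : 0 < Real.cos (3 * Real.pi / 8) :=
    Real.cos_pos_of_mem_Ioo ⟨by linarith, by linarith⟩
  have h3 : Real.cos (3 * Real.pi / 8) ≤ Real.cos (x + Real.pi / 4) := by
    rw [← Real.cos_abs (x + Real.pi / 4)]
    refine Real.cos_le_cos_of_nonneg_of_le_pi (abs_nonneg _) (by linarith) ?_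
    rw [abs_le]
    constructor <;> linarith
  rw [Real.cos_add, Real.cos_pi_div_four, Real.sin_pi_div_four] at h3
  have h4 : 0 < √2 := by positivity
  have h5 : √2 < 2 := by
    rw [Real.sqrt_lt' (by norm_num)]
    norm_num
  nlinarith

lemma exists_coercive_dilatedPotential {β : ℝ} (hβ : 0 < β) (η : ℂ) :
    ∃ R : ℝ, 0 < R ∧ ∀ σ ∈ dilationStrip β, ∀ y, R ≤ y →
      1 ≤ ((1 - Complex.I) * dilatedPotential β η σ y).re := by
  set k := Real.exp (-(β + 2)) * Real.cos (3 * Real.pi / 8) with hk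
  have hpi := Real.pi_pos
  have hcos : 0 < Real.cos (3 * Real.pi / 8) :=
    Real.cos_pos_of_mem_Ioo ⟨by linarith, by linarith⟩
  have hk0 : 0 < k := mul_pos (Real.exp_pos _) hcos
  obtain ⟨R, hR, hRy⟩ := exists_forall_le_rpow hβ ((1 + 2 * (‖η‖ * Real.exp 2)) / k)
  refine ⟨R, hR, fun σ hσ y hy => ?_⟩
  obtain ⟨h1, h2, h3, h4⟩ := hσ
  have hy' := hRy y hy
  rw [div_le_iff₀ hk0] at hy'
  have ht : 0 ≤ y ^ β := Real.rpow_nonneg (hR.le.trans hy) _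
  have e1 : (((1 - Complex.I) * (Complex.I * Complex.exp ((β + 2) * σ))).re) =
      Real.exp ((β + 2) * σ.re) * (Real.cos ((β + 2) * σ.im) - Real.sin ((β + 2) * σ.im)) := by
    simp [Complex.exp_re, Complex.exp_im]
    ring
  have e2 : k ≤ Real.exp ((β + 2) * σ.re) *
      (Real.cos ((β + 2) * σ.im) - Real.sin ((β + 2) * σ.im)) := by
    rw [hk]
    refine mul_le_mul (Real.exp_le_exp.2 (by nlinarith)) (cos_le_cos_sub_sin h3 h4) hcos.le
      (Real.exp_pos _).le
  have e3 := (abs_le.1 (abs_re_one_sub_I_mul_le (η * Complex.exp (2 * σ)))).2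
  have e4 : ‖η * Complex.exp (2 * σ)‖ ≤ ‖η‖ * Real.exp 2 := by
    rw [norm_mul, Complex.norm_exp]
    gcongr
    simp
    linarith
  have e5 : ((1 - Complex.I) * dilatedPotential β η σ y).re =
      ((1 - Complex.I) * (Complex.I * Complex.exp ((β + 2) * σ))).re * y ^ β -
        ((1 - Complex.I) * (η * Complex.exp (2 * σ))).re := by
    rw [← Complex.re_mul_ofReal, ← Complex.sub_re, dilatedPotential]
    congr 1
    ring
  rw [e5, e1]
  nlinarith [mul_le_mul_of_nonneg_right e2 ht]

lemma HasFiniteEnergy.comp_mul_left {w v : ℝ → ℂ} (hw : IntegrableOn (fun x => ‖w x‖ ^ 2) (Ioi 0))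
    (hv : IntegrableOn (fun x => ‖v x‖ ^ 2) (Ioi 0)) {s : ℝ} (hs : 0 < s) :
    HasFiniteEnergy (fun y => w (s * y)) (fun y => s * v (s * y)) := by
  have h1 := (integrableOn_Ioi_comp_mul_left_iff _ 0 hs).2 ((mul_zero s).symm ▸ hw)
  have h2 := (integrableOn_Ioi_comp_mul_left_iff _ 0 hs).2 ((mul_zero s).symm ▸ hv)
  refine (h1.add (h2.const_mul (s ^ 2))).congr (Eventually.of_forall fun y => ?_)
  simp [mul_pow]

lemma isRegularSolution_dilation {β : ℝ} {η : ℂ} {F F' F'' : ℝ → ℂ}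
    (hF : ∀ x ∈ Ici (0:ℝ), HasDerivWithinAt F (F' x) (Ici 0) x)
    (hF' : ∀ x ∈ Ici (0:ℝ), HasDerivWithinAt F' (F'' x) (Ici 0) x)
    (heq : ∀ x : ℝ, 0 ≤ x → -F'' x + Complex.I * ((x ^ β : ℝ) : ℂ) * F x - η * F x = 0) (σ : ℝ) :
    IsRegularSolution (dilatedPotential β η σ) (fun y => F (Real.exp σ * y))
      (fun y => (Real.exp σ : ℂ) * F' (Real.exp σ * y)) := by
  have hs := Real.exp_pos σ
  have hmaps : MapsTo (fun y => Real.exp σ * y) (Ici 0) (Ici 0) := fun y hy =>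
    mul_nonneg hs.le hy
  have hcm : ContinuousOn (fun y => Real.exp σ * y) (Ici 0) := by fun_prop
  have cF : ContinuousOn F (Ici 0) := fun x hx => (hF x hx).continuousWithinAt
  have cF' : ContinuousOn F' (Ici 0) := fun x hx => (hF' x hx).continuousWithinAt
  refine ⟨fun y hy => ?_, cF.comp hcm hmaps, continuousOn_const.mul (cF'.comp hcm hmaps)⟩
  have hsy : 0 < Real.exp σ * y := mul_pos hs hy
  have hnhds : Ici (0:ℝ) ∈ 𝓝 (Real.exp σ * y) := Ici_mem_nhds hsy
  have dm : HasDerivAt (fun y => Real.exp σ * y) (Real.exp σ) y := by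
    simpa using (hasDerivAt_id y).const_mul (Real.exp σ)
  have d1 := ((hF _ hsy.le).hasDerivAt hnhds).scomp y dm
  have d2 := (((hF' _ hsy.le).hasDerivAt hnhds).scomp y dm).const_mul (Real.exp σ : ℂ)
  refine ⟨d1.congr_deriv Complex.real_smul, ?_⟩
  convert! d2 using 1
  have h := heq _ hsy.le
  have h1 : F'' (Real.exp σ * y) =
      (Complex.I * (((Real.exp σ * y) ^ β : ℝ) : ℂ) - η) * F (Real.exp σ * y) := by
    linear_combination -h
  rw [h1, Real.mul_rpow hs.le hy.le, ← Real.exp_mul]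
  have h2 : Complex.exp ((β + 2) * σ) =
      (Real.exp σ : ℂ) * (Real.exp σ : ℂ) * ((Real.exp (σ * β) : ℝ) : ℂ) := by
    push_cast
    rw [← Complex.exp_add, ← Complex.exp_add]
    congr 1
    ring
  have h3 : Complex.exp (2 * σ) = (Real.exp σ : ℂ) * (Real.exp σ : ℂ) := by
    push_cast
    rw [← Complex.exp_add]
    congr 1
    ring
  simp only [dilatedPotential, h2, h3, Complex.real_smul]
  push_cast
  ring

/-- Complex dilation by the angle `-π / (2 (β + 2))` turns a square-integrable solution of
`F'' = (i x ^ β - η) F` into one of `G'' = (x ^ β - μ) G`. -/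
lemma exists_rotated_solution {β : ℝ} (hβ : 0 < β) {η : ℂ} {F F' F'' : ℝ → ℂ}
    (hF : ∀ x ∈ Ici (0:ℝ), HasDerivWithinAt F (F' x) (Ici 0) x)
    (hF' : ∀ x ∈ Ici (0:ℝ), HasDerivWithinAt F' (F'' x) (Ici 0) x)
    (iF : IntegrableOn (fun x => ‖F x‖ ^ 2) (Ioi 0))
    (iF' : IntegrableOn (fun x => ‖F' x‖ ^ 2) (Ioi 0)) (hF'0 : F' 0 = 1)
    (heq : ∀ x : ℝ, 0 ≤ x → -F'' x + Complex.I * ((x ^ β : ℝ) : ℂ) * F x - η * F x = 0)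
    {σ : ℂ} (hσ : σ = ((-(Real.pi / (2 * (β + 2))) : ℝ) : ℂ) * Complex.I) :
    ∃ w v, IsRegularSolution (fun y => ((y ^ β : ℝ) : ℂ) - η * Complex.exp (2 * σ)) w v ∧
      HasFiniteEnergy w v ∧ w 0 = F 0 ∧ v 0 = Complex.exp σ := by
  have hpi := Real.pi_pos
  obtain ⟨R, hR, hcoer⟩ := exists_coercive_dilatedPotential hβ η
  obtain ⟨hex, D, N, hD, hN, hDN⟩ := exists_boundary_condition
    (continuous_dilatedPotential hβ.le η) (differentiable_dilatedPotential β η)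
    (isOpen_dilationStrip β) hR hcoer
  have hpre := (convex_dilationStrip β).isPreconnected
  have h0 : (0:ℂ) ∈ dilationStrip β := by
    simp only [dilationStrip, mem_ofPred_eq, Complex.zero_re, Complex.zero_im]
    refine ⟨?_, ?_, ?_, ?_⟩ <;> linarith
  have hreal : ∀ s : ℝ, (s : ℂ) ∈ dilationStrip β →
      F 0 * D s + Complex.exp s * N s = 0 := by
    intro s hs
    have := (hDN s hs _ _ (isRegularSolution_dilation hF hF' heq s)).1
      (HasFiniteEnergy.comp_mul_left iF iF' (Real.exp_pos s))
    simpa [hF'0] using this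
  have hH : DifferentiableOn ℂ (fun σ => F 0 * D σ + Complex.exp σ * N σ) (dilationStrip β) :=
    (hD.const_mul _).add (Complex.differentiable_exp.differentiableOn.mul hN)
  have hfreq : ∃ᶠ z in 𝓝[≠] (0:ℂ), F 0 * D z + Complex.exp z * N z = 0 := by
    have ht : Tendsto (fun s : ℝ => (s : ℂ)) (𝓝[≠] 0) (𝓝[≠] (0:ℂ)) := by
      refine tendsto_nhdsWithin_of_tendsto_nhds_of_eventually_within _ ?_ ?_
      · exact (Complex.continuous_ofReal.tendsto' 0 0 Complex.ofReal_zero).mono_left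
          nhdsWithin_le_nhds
      · filter_upwards [self_mem_nhdsWithin] with s hs
        simpa using hs
    refine ht.frequently (Eventually.frequently ?_)
    filter_upwards [ht.eventually (mem_nhdsWithin_of_mem_nhds
      ((isOpen_dilationStrip β).mem_nhds h0))] with s hs
    exact hreal s hs
  have hσmem : σ ∈ dilationStrip β := by
    have : (β + 2) * (Real.pi / (2 * (β + 2))) = Real.pi / 2 := by field_simp
    simp only [dilationStrip, mem_ofPred_eq, hσ, Complex.mul_re, Complex.mul_im, Complex.ofReal_re,
      Complex.ofReal_im, Complex.I_re, Complex.I_im]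
    refine ⟨?_, ?_, ?_, ?_⟩ <;> nlinarith
  have hzero := AnalyticOnNhd.eqOn_zero_of_preconnected_of_frequently_eq_zero
    (hH.analyticOnNhd (isOpen_dilationStrip β)) hpre h0 hfreq hσmem
  obtain ⟨w, v, hwv, hw0, hv0⟩ := hex σ (F 0) (Complex.exp σ)
  have hpot : dilatedPotential β η σ =
      fun y => ((y ^ β : ℝ) : ℂ) - η * Complex.exp (2 * σ) := by
    have hβ2 : (β : ℂ) + 2 ≠ 0 := by
      have : ((β + 2 : ℝ) : ℂ) ≠ 0 := Complex.ofReal_ne_zero.2 (by positivity)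
      simpa using this
    have : Complex.I * Complex.exp ((β + 2) * σ) = 1 := by
      have e : ((β : ℂ) + 2) * σ = -(Real.pi / 2 * Complex.I) := by
        rw [hσ]
        push_cast
        field_simp
      rw [e, Complex.exp_neg, Complex.exp_pi_div_two_mul_I]
      simp
    funext y
    rw [dilatedPotential, this, one_mul]
  exact ⟨w, v, hpot ▸ hwv, (hDN σ hσmem w v hwv).2 (by rw [hw0, hv0]; exact hzero), hw0, hv0⟩

lemma exists_ge_le_of_integrableOn_Ioi {f : ℝ → ℝ} (hf : IntegrableOn f (Ioi 0)) {X ε : ℝ}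
    (hε : 0 < ε) : ∃ y, X ≤ y ∧ 0 < y ∧ f y ≤ ε := by
  by_contra! h
  have h1 : IntegrableOn (fun _ => ε) (Ioi (max X 0)) := by
    refine Integrable.mono' (hf.mono_set (Ioi_subset_Ioi (le_max_right X 0)))
      aestronglyMeasurable_const ?_
    filter_upwards [ae_restrict_mem measurableSet_Ioi] with y hy
    rw [Real.norm_of_nonneg hε.le]
    exact (h y ((le_max_left X 0).trans (le_of_lt hy)) ((le_max_right X 0).trans_lt hy)).le
  rw [integrableOn_const_iff] at h1
  simp [hε.ne'] at h1

namespace IsRegularSolution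

variable {q w v : ℝ → ℂ}

lemma hasDerivWithinAt (h : IsRegularSolution q w v) :
    ∀ x ∈ Ici (0:ℝ), HasDerivWithinAt w (v x) (Ici 0) x := by
  intro x hx
  rcases eq_or_lt_of_le (mem_Ici.1 hx) with rfl | hx
  · refine hasDerivWithinAt_Ici_of_tendsto_deriv (s := Ioi 0)
      (fun y hy => (h.isSolution y hy).1.differentiableAt.differentiableWithinAt)
      ((h.continuousOn_fst 0 self_mem_Ici).mono Ioi_subset_Ici_self) self_mem_nhdsWithin ?_
    refine ((h.continuousOn_snd 0 self_mem_Ici).mono Ioi_subset_Ici_self).tendsto.congr' ?_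
    filter_upwards [self_mem_nhdsWithin] with y hy
    exact (h.isSolution y hy).1.deriv.symm
  · exact (h.isSolution x hx).1.hasDerivWithinAt

lemma integrableOn_sq (h : IsRegularSolution q w v) (hE : HasFiniteEnergy w v) :
    IntegrableOn (fun y => ‖w y‖ ^ 2) (Ioi 0) ∧ IntegrableOn (fun y => ‖v y‖ ^ 2) (Ioi 0) := by
  constructor
  · refine Integrable.mono' hE ((h.isSolution.continuousOn_fst.norm.pow 2).aestronglyMeasurable
      measurableSet_Ioi) (Eventually.of_forall fun y => ?_)
    rw [Real.norm_of_nonneg (by positivity)]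
    linarith [sq_nonneg ‖v y‖]
  · refine Integrable.mono' hE ((h.isSolution.continuousOn_snd.norm.pow 2).aestronglyMeasurable
      measurableSet_Ioi) (Eventually.of_forall fun y => ?_)
    rw [Real.norm_of_nonneg (by positivity)]
    linarith [sq_nonneg ‖w y‖]

/-- Integration by parts for `w'' = (x ^ β - μ) w` with Neumann condition at `0`. -/
lemma integral_form_le {β : ℝ} (hβ : 0 ≤ β) {μ : ℂ}
    (h : IsRegularSolution (fun y => ((y ^ β : ℝ) : ℂ) - μ) w v) (hE : HasFiniteEnergy w v)
    (hv : v 0 = 0) :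
    IntegrableOn (fun y => ‖v y‖ ^ 2 + y ^ β * ‖w y‖ ^ 2) (Ioi 0) ∧
      ∫ y in Ioi 0, (‖v y‖ ^ 2 + y ^ β * ‖w y‖ ^ 2) ≤ ‖μ‖ * ∫ y in Ioi 0, ‖w y‖ ^ 2 := by
  have hrp : Continuous fun y : ℝ => y ^ β := Real.continuous_rpow_const hβ
  have hp : ContinuousOn (fun y => ‖v y‖ ^ 2 + y ^ β * ‖w y‖ ^ 2) (Ici 0) :=
    (h.continuousOn_snd.norm.pow 2).add (hrp.continuousOn.mul (h.continuousOn_fst.norm.pow 2))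
  have hw2 : ContinuousOn (fun y => ‖w y‖ ^ 2) (Ici 0) := h.continuousOn_fst.norm.pow 2
  set K := ∫ y in Ioi 0, ‖w y‖ ^ 2
  have hb : ∀ X, 0 ≤ X → ∫ y in (0:ℝ)..X, (‖v y‖ ^ 2 + y ^ β * ‖w y‖ ^ 2) ≤
      ‖w X‖ ^ 2 + ‖v X‖ ^ 2 + ‖μ‖ * K := by
    intro X hX
    let b : ℝ → ℝ := fun y => (starRingEnd ℂ (w y) * v y).re
    have hi1 : IntervalIntegrable (fun y => ‖v y‖ ^ 2 + y ^ β * ‖w y‖ ^ 2) volume 0 X :=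
      (hp.mono (by rw [uIcc_of_le hX]; exact Icc_subset_Ici_self)).intervalIntegrable
    have hi2 : IntervalIntegrable (fun y => ‖μ‖ * ‖w y‖ ^ 2) volume 0 X :=
      ((hw2.mono (by rw [uIcc_of_le hX]; exact Icc_subset_Ici_self)).intervalIntegrable).const_mul _
    have h1 : ∫ y in (0:ℝ)..X, (‖v y‖ ^ 2 + y ^ β * ‖w y‖ ^ 2 - ‖μ‖ * ‖w y‖ ^ 2) ≤ b X - b 0 := by
      refine intervalIntegral.integral_le_sub_of_hasDeriv_right_of_le hX
        (g' := fun y => ‖v y‖ ^ 2 + (y ^ β - μ.re) * ‖w y‖ ^ 2)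
        (Complex.continuous_re.comp_continuousOn
          (((Complex.continuous_conj.comp_continuousOn h.continuousOn_fst).mul
            h.continuousOn_snd).mono Icc_subset_Ici_self)) (fun y hy => ?_)
        ((hp.sub (continuousOn_const.mul hw2)).mono Icc_subset_Ici_self).integrableOn_Icc
        fun y _ => ?_
      · have h2 := Complex.reCLM.hasFDerivAt.comp_hasDerivAt y
          (h.isSolution.hasDerivAt_conj_mul hy.1)
        refine HasDerivAt.hasDerivWithinAt ?_
        convert! h2 using 1
        simp only [Complex.reCLM_apply, Complex.add_re, Complex.re_mul_ofReal, Complex.sub_re,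
          Complex.ofReal_re]
      · nlinarith [Complex.re_le_norm μ, sq_nonneg ‖w y‖]
    have hb0 : b 0 = 0 := by simp [b, hv]
    have hbX : b X ≤ ‖w X‖ ^ 2 + ‖v X‖ ^ 2 := by
      refine (Complex.re_le_norm _).trans ?_
      rw [norm_mul, RCLike.norm_conj]
      nlinarith [sq_nonneg (‖w X‖ - ‖v X‖), sq_nonneg (‖w X‖ + ‖v X‖)]
    have hK : ∫ y in (0:ℝ)..X, ‖w y‖ ^ 2 ≤ K := by
      rw [intervalIntegral.integral_of_le hX]
      exact setIntegral_mono_set (h.integrableOn_sq hE).1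
        (Eventually.of_forall fun y => by positivity)
        (Eventually.of_forall fun y hy => hy.1)
    rw [intervalIntegral.integral_sub hi1 hi2, intervalIntegral.integral_const_mul] at h1
    nlinarith [norm_nonneg μ, mul_le_mul_of_nonneg_left hK (norm_nonneg μ)]
  have hX : ∀ n : ℕ, ∃ y, (n : ℝ) ≤ y ∧ 0 < y ∧ ‖w y‖ ^ 2 + ‖v y‖ ^ 2 ≤ 1 / ((n : ℝ) + 1) :=
    fun n => exists_ge_le_of_integrableOn_Ioi hE (by positivity)
  choose X hnX hX0 hXE using hX
  have hXlim : Tendsto X atTop atTop := tendsto_atTop_mono hnX tendsto_natCast_atTop_atTop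
  have hnorm : ∀ n, ∫ y in (0:ℝ)..X n, ‖‖v y‖ ^ 2 + y ^ β * ‖w y‖ ^ 2‖ =
      ∫ y in (0:ℝ)..X n, (‖v y‖ ^ 2 + y ^ β * ‖w y‖ ^ 2) := by
    intro n
    refine intervalIntegral.integral_congr fun y hy => Real.norm_of_nonneg ?_
    rw [uIcc_of_le (hX0 n).le] at hy
    have := Real.rpow_nonneg hy.1 β
    positivity
  have hform : IntegrableOn (fun y => ‖v y‖ ^ 2 + y ^ β * ‖w y‖ ^ 2) (Ioi 0) := by
    refine integrableOn_Ioi_of_intervalIntegral_norm_bounded (1 + ‖μ‖ * K) 0 (b := X) (l := atTop)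
      (fun n => (hp.mono Icc_subset_Ici_self).integrableOn_Icc.mono_set Ioc_subset_Icc_self) hXlim
      (Eventually.of_forall fun n => ?_)
    rw [hnorm]
    have h1 : 1 / ((n : ℝ) + 1) ≤ 1 := by
      rw [div_le_one (by positivity)]
      linarith [(n.cast_nonneg : (0:ℝ) ≤ n)]
    linarith [hb (X n) (hX0 n).le, hXE n]
  refine ⟨hform, le_of_tendsto_of_tendsto' (intervalIntegral_tendsto_integral_Ioi 0 hform hXlim)
    (g := fun n : ℕ => 1 / ((n : ℝ) + 1) + ‖μ‖ * K) ?_ fun n => ?_⟩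
  · simpa using (tendsto_one_div_add_atTop_nhds_zero_nat (𝕜 := ℝ)).add_const (‖μ‖ * K)
  · linarith [hb (X n) (hX0 n).le, hXE n]

end IsRegularSolution

/-- The numbers `μ` with `‖μ‖ < c` are not Neumann eigenvalues of `-d²/dx² + x ^ β`. -/
lemma IsRegularSolution.apply_zero_eq_zero {β : ℝ} (hβ : 0 ≤ β) {c : ℝ}
    (hspec : ∀ u u' : ℝ → ℂ,
        (∀ x ∈ Ici (0:ℝ), HasDerivWithinAt u (u' x) (Ici 0) x) →
        ContinuousOn u' (Ici 0) →
        IntegrableOn (fun x => ‖u x‖ ^ 2) (Ioi 0) →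
        IntegrableOn (fun x => ‖u' x‖ ^ 2) (Ioi 0) →
        ENNReal.ofReal c * (∫⁻ x in Ioi (0:ℝ), ENNReal.ofReal (‖u x‖ ^ 2)) ≤
          (∫⁻ x in Ioi (0:ℝ), ENNReal.ofReal (‖u' x‖ ^ 2)) +
            ∫⁻ x in Ioi (0:ℝ), ENNReal.ofReal (x ^ β * ‖u x‖ ^ 2))
    {μ : ℂ} (hμ : ‖μ‖ < c) {w v : ℝ → ℂ}
    (h : IsRegularSolution (fun y => ((y ^ β : ℝ) : ℂ) - μ) w v) (hE : HasFiniteEnergy w v)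
    (hv : v 0 = 0) : w 0 = 0 := by
  have hc : 0 < c := (norm_nonneg μ).trans_lt hμ
  obtain ⟨iw, iv⟩ := h.integrableOn_sq hE
  obtain ⟨hform, hle⟩ := h.integral_form_le hβ hE hv
  have h1 := hspec w v h.hasDerivWithinAt h.continuousOn_snd iw iv
  rw [← lintegral_add_left' iv.aemeasurable.ennreal_ofReal] at h1
  have h2 : ∫⁻ x in Ioi (0:ℝ), (ENNReal.ofReal (‖v x‖ ^ 2) +
      ENNReal.ofReal (x ^ β * ‖w x‖ ^ 2)) =
      ∫⁻ x in Ioi (0:ℝ), ENNReal.ofReal (‖v x‖ ^ 2 + x ^ β * ‖w x‖ ^ 2) := by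
    refine setLIntegral_congr_fun measurableSet_Ioi fun x hx => ?_
    have := Real.rpow_nonneg (le_of_lt hx) β
    exact (ENNReal.ofReal_add (by positivity) (by positivity)).symm
  have hnn : 0 ≤ᵐ[volume.restrict (Ioi 0)] fun x : ℝ => ‖v x‖ ^ 2 + x ^ β * ‖w x‖ ^ 2 := by
    filter_upwards [ae_restrict_mem measurableSet_Ioi] with x hx
    have := Real.rpow_nonneg (le_of_lt hx) β
    simp only [Pi.zero_apply]
    positivity
  have hK0 : 0 ≤ ∫ x in Ioi 0, ‖w x‖ ^ 2 := integral_nonneg fun x => by positivity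
  rw [h2, ← ofReal_integral_eq_lintegral_ofReal hform hnn, ← ofReal_integral_eq_lintegral_ofReal iw
    (Eventually.of_forall fun x => by positivity), ← ENNReal.ofReal_mul hc.le,
    ENNReal.ofReal_le_ofReal_iff (integral_nonneg_of_ae hnn)] at h1
  have hK : ∫ x in Ioi 0, ‖w x‖ ^ 2 = 0 := by nlinarith
  rw [integral_eq_zero_iff_of_nonneg (fun x => by positivity) iw] at hK
  have h3 : w =ᵐ[volume.restrict (Ici 0)] fun _ => 0 := by
    rw [← Measure.restrict_congr_set (Ioi_ae_eq_Ici (μ := volume) (a := (0:ℝ)))]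
    filter_upwards [hK] with x hx
    simpa using hx
  exact Measure.eqOn_of_ae_eq h3 h.continuousOn_fst continuousOn_const
    (by rw [interior_Ici, closure_Ioi]) self_mem_Ici

theorem exists_dirichlet_data_of_pos {β : ℝ} (hβ : 0 < β) {c : ℝ}
    (hspec : ∀ u u' : ℝ → ℂ,
        (∀ x ∈ Ici (0:ℝ), HasDerivWithinAt u (u' x) (Ici 0) x) →
        ContinuousOn u' (Ici 0) →
        IntegrableOn (fun x => ‖u x‖ ^ 2) (Ioi 0) →
        IntegrableOn (fun x => ‖u' x‖ ^ 2) (Ioi 0) →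
        ENNReal.ofReal c * (∫⁻ x in Ioi (0:ℝ), ENNReal.ofReal (‖u x‖ ^ 2)) ≤
          (∫⁻ x in Ioi (0:ℝ), ENNReal.ofReal (‖u' x‖ ^ 2)) +
            ∫⁻ x in Ioi (0:ℝ), ENNReal.ofReal (x ^ β * ‖u x‖ ^ 2)) :
    ∃ Ψ : ℂ → ℂ, DifferentiableOn ℂ Ψ (Metric.ball 0 c) ∧
      ∀ η ∈ Metric.ball (0:ℂ) c,
        ∀ F F' F'' : ℝ → ℂ,
          (∀ x ∈ Ici (0:ℝ), HasDerivWithinAt F (F' x) (Ici 0) x) →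
          (∀ x ∈ Ici (0:ℝ), HasDerivWithinAt F' (F'' x) (Ici 0) x) →
          IntegrableOn (fun x => ‖F x‖ ^ 2) (Ioi 0) →
          IntegrableOn (fun x => ‖F' x‖ ^ 2) (Ioi 0) →
          F' 0 = 1 →
          (∀ x : ℝ, 0 ≤ x →
            -F'' x + Complex.I * ((x ^ β : ℝ) : ℂ) * F x - η * F x = 0) →
          F 0 = Ψ η := by
  obtain ⟨σ, hσ⟩ : ∃ σ, σ = ((-(Real.pi / (2 * (β + 2))) : ℝ) : ℂ) * Complex.I := ⟨_, rfl⟩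
  have hrot : ‖Complex.exp (2 * σ)‖ = 1 := by
    have : 2 * σ = ((2 * -(Real.pi / (2 * (β + 2))) : ℝ) : ℂ) * Complex.I := by
      rw [hσ, Complex.ofReal_mul, Complex.ofReal_ofNat, mul_assoc]
    rw [this, Complex.norm_exp_ofReal_mul_I]
  obtain ⟨R, hR, hRy⟩ := exists_forall_le_rpow hβ (1 + 2 * c)
  have hrp : Continuous fun p : ℂ × ℝ => p.2 ^ β :=
    (Real.continuous_rpow_const hβ.le).comp continuous_snd
  obtain ⟨hex, D, N, hD, hN, hDN⟩ := exists_boundary_condition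
    (q := fun η y => ((y ^ β : ℝ) : ℂ) - η * Complex.exp (2 * σ))
    (by unfold Function.uncurry; fun_prop) (fun y => by fun_prop)
    (Metric.isOpen_ball (x := (0:ℂ)) (ε := c)) hR (fun η hη y hy => by
      rw [mem_ball_zero_iff] at hη
      have h1 := (abs_le.1 (abs_re_one_sub_I_mul_le (η * Complex.exp (2 * σ)))).2
      rw [norm_mul, hrot, mul_one] at h1
      rw [mul_sub, Complex.sub_re, Complex.re_mul_ofReal]
      have h2 : (1 - Complex.I).re = 1 := by simp
      rw [h2]
      linarith [hRy y hy])
  have hne : ∀ η ∈ Metric.ball (0:ℂ) c, D η ≠ 0 := by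
    intro η hη h0
    obtain ⟨w, v, hwv, hw, hv⟩ := hex η 1 0
    have h1 := (hDN η hη w v hwv).2 (by rw [hv, h0]; ring)
    rw [mem_ball_zero_iff] at hη
    have h2 := hwv.apply_zero_eq_zero hβ.le hspec (by rwa [norm_mul, hrot, mul_one]) h1 hv
    rw [hw] at h2
    exact one_ne_zero h2
  refine ⟨fun η => -(Complex.exp σ * N η) / D η, (hN.const_mul _).neg.div hD hne, ?_⟩
  intro η hη F F' F'' hF hF' iF iF' hF'0 heq
  obtain ⟨w, v, hwv, hE, hw, hv⟩ := exists_rotated_solution hβ hF hF' iF iF' hF'0 heq hσ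
  have := (hDN η hη w v hwv).1 hE
  rw [hw, hv] at this
  rw [eq_div_iff (hne η hη)]
  linear_combination this

/-- The spectrum of the Neumann Laplacian plus one on the half line starts at `1`. -/
lemma spectral_bound_le_one {c : ℝ}
    (hspec : ∀ u u' : ℝ → ℂ,
        (∀ x ∈ Ici (0:ℝ), HasDerivWithinAt u (u' x) (Ici 0) x) →
        ContinuousOn u' (Ici 0) →
        IntegrableOn (fun x => ‖u x‖ ^ 2) (Ioi 0) →
        IntegrableOn (fun x => ‖u' x‖ ^ 2) (Ioi 0) →
        ENNReal.ofReal c * (∫⁻ x in Ioi (0:ℝ), ENNReal.ofReal (‖u x‖ ^ 2)) ≤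
          (∫⁻ x in Ioi (0:ℝ), ENNReal.ofReal (‖u' x‖ ^ 2)) +
            ∫⁻ x in Ioi (0:ℝ), ENNReal.ofReal (x ^ (0:ℝ) * ‖u x‖ ^ 2)) : c ≤ 1 := by
  have key : ∀ ε : ℝ, 0 < ε → c ≤ ε ^ 2 + 1 := by
    intro ε hε
    have hu : ∀ x, HasDerivAt (fun x : ℝ => ((Real.exp (-ε * x) : ℝ) : ℂ))
        (((-ε * Real.exp (-ε * x) : ℝ)) : ℂ) x := by
      intro x
      have := ((hasDerivAt_id x).const_mul (-ε)).exp.ofReal_comp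
      convert! this using 2
      simp [mul_comm]
    have hn : ∀ x : ℝ, ‖((Real.exp (-ε * x) : ℝ) : ℂ)‖ ^ 2 = Real.exp (-(2 * ε) * x) := by
      intro x
      rw [Complex.norm_real, Real.norm_of_nonneg (Real.exp_pos _).le, ← Real.exp_nat_mul]
      congr 1
      push_cast
      ring
    have hn' : ∀ x : ℝ, ‖((-ε * Real.exp (-ε * x) : ℝ) : ℂ)‖ ^ 2 =
        ε ^ 2 * Real.exp (-(2 * ε) * x) := by
      intro x
      rw [← hn, Complex.ofReal_mul, norm_mul, mul_pow]
      simp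
    have hi : IntegrableOn (fun x => Real.exp (-(2 * ε) * x)) (Ioi 0) :=
      exp_neg_integrableOn_Ioi 0 (by positivity)
    have hi' : IntegrableOn (fun x => ε ^ 2 * Real.exp (-(2 * ε) * x)) (Ioi 0) := hi.const_mul _
    have h := hspec _ _ (fun x _ => (hu x).hasDerivWithinAt) (by fun_prop)
      (by simpa only [hn] using hi) (by simpa only [hn'] using hi')
    simp only [hn, hn', Real.rpow_zero, one_mul] at h
    have hpos : 0 < ∫ x in Ioi 0, Real.exp (-(2 * ε) * x) := by
      rw [setIntegral_pos_iff_support_of_nonneg_ae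
        (Eventually.of_forall fun x => (Real.exp_pos _).le) hi]
      have : Function.support (fun x : ℝ => Real.exp (-(2 * ε) * x)) = univ := by
        ext x
        simp
      rw [this, univ_inter]
      simp
    have hnn : ∀ x : ℝ, 0 ≤ Real.exp (-(2 * ε) * x) := fun x => (Real.exp_pos _).le
    rw [← ofReal_integral_eq_lintegral_ofReal hi (Eventually.of_forall hnn),
      ← ofReal_integral_eq_lintegral_ofReal hi'
        (Eventually.of_forall fun x => mul_nonneg (sq_nonneg ε) (hnn x)),
      integral_const_mul, ← ENNReal.ofReal_add (by positivity) hpos.le,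
      ← ENNReal.ofReal_mul' hpos.le, ENNReal.ofReal_le_ofReal_iff (by positivity)] at h
    nlinarith
  by_contra! hlt
  have h1 : 0 < √((c - 1) / 2) := Real.sqrt_pos.2 (by linarith)
  have h2 := key _ h1
  rw [Real.sq_sqrt (by linarith)] at h2
  linarith

/-- Square-integrable solutions of `F'' = κ² F` with `0 < re κ` satisfy `F' 0 = -κ F 0`. -/
lemma apply_zero_eq_of_sq_re_pos {κ : ℂ} (hκ : 0 < κ.re) {F F' F'' : ℝ → ℂ}
    (hF : ∀ x ∈ Ici (0:ℝ), HasDerivWithinAt F (F' x) (Ici 0) x)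
    (hF' : ∀ x ∈ Ici (0:ℝ), HasDerivWithinAt F' (F'' x) (Ici 0) x)
    (iF : IntegrableOn (fun x => ‖F x‖ ^ 2) (Ioi 0))
    (iF' : IntegrableOn (fun x => ‖F' x‖ ^ 2) (Ioi 0))
    (heq : ∀ x : ℝ, 0 ≤ x → F'' x = κ ^ 2 * F x) : F' 0 = -(κ * F 0) := by
  have hE : ∀ x : ℝ,
      HasDerivAt (fun x : ℝ => Complex.exp (-κ * x)) (-κ * Complex.exp (-κ * x)) x := by
    intro x
    have := ((hasDerivAt_id x).ofReal_comp.const_mul (-κ)).cexp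
    convert! this using 1
    simp [mul_comm]
  have hd : ∀ x ∈ Ici (0:ℝ), HasDerivWithinAt
      (fun x => (F' x + κ * F x) * Complex.exp (-κ * x)) 0 (Ici 0) x := by
    intro x hx
    have h1 := ((hF' x hx).add ((hF x hx).const_mul κ)).mul (hE x).hasDerivWithinAt
    convert! h1 using 1
    simp only [Pi.add_apply, heq x hx]
    ring
  have hconst : ∀ x : ℝ, 0 ≤ x → (F' x + κ * F x) * Complex.exp (-κ * x) = F' 0 + κ * F 0 := by
    intro x hx
    have := constant_of_has_deriv_right_zero (a := 0) (b := x)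
      (fun y hy => ((hd y hy.1).continuousWithinAt).mono Icc_subset_Ici_self)
      (fun y hy => (hd y hy.1).mono (Ici_subset_Ici.2 hy.1)) x ⟨hx, le_rfl⟩
    simpa using this
  have hle : ∀ x : ℝ, 0 ≤ x →
      ‖F' 0 + κ * F 0‖ ^ 2 ≤ 2 * (‖F' x‖ ^ 2 + ‖κ‖ ^ 2 * ‖F x‖ ^ 2) := by
    intro x hx
    have h1 : ‖Complex.exp (-κ * x)‖ ≤ 1 := by
      rw [Complex.norm_exp, Real.exp_le_one_iff]
      simp only [Complex.re_mul_ofReal, Complex.neg_re]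
      nlinarith
    have h2 : ‖F' 0 + κ * F 0‖ ≤ ‖F' x‖ + ‖κ‖ * ‖F x‖ := by
      rw [← hconst x hx, norm_mul, ← norm_mul κ]
      exact (mul_le_of_le_one_right (norm_nonneg _) h1).trans (norm_add_le _ _)
    have h3 : ‖F' 0 + κ * F 0‖ ^ 2 ≤ (‖F' x‖ + ‖κ‖ * ‖F x‖) ^ 2 := by gcongr
    nlinarith [sq_nonneg (‖F' x‖ - ‖κ‖ * ‖F x‖)]
  have hi : IntegrableOn (fun x => 2 * (‖F' x‖ ^ 2 + ‖κ‖ ^ 2 * ‖F x‖ ^ 2)) (Ioi 0) :=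
    (iF'.add (iF.const_mul (‖κ‖ ^ 2))).const_mul 2
  by_contra hne
  have hpos : 0 < ‖F' 0 + κ * F 0‖ ^ 2 :=
    pow_pos (norm_pos_iff.2 fun h => hne (eq_neg_of_add_eq_zero_left h)) 2
  obtain ⟨x, -, hx, hx'⟩ := exists_ge_le_of_integrableOn_Ioi hi (X := 0) (half_pos hpos)
  linarith [hle x hx.le]

lemma I_sub_mem_slitPlane {η : ℂ} (hη : ‖η‖ < 1) : Complex.I - η ∈ Complex.slitPlane := by
  refine Or.inr (ne_of_gt ?_)
  have := Complex.im_le_norm η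
  simp only [Complex.sub_im, Complex.I_im]
  linarith

lemma exp_log_div_two_re_pos {z : ℂ} (hz : z ∈ Complex.slitPlane) :
    0 < (Complex.exp (Complex.log z / 2)).re := by
  rw [Complex.exp_re]
  refine mul_pos (Real.exp_pos _) (Real.cos_pos_of_mem_Ioo ?_)
  have h1 := Complex.neg_pi_lt_arg z
  have h2 := lt_of_le_of_ne (Complex.arg_le_pi z) (Complex.mem_slitPlane_iff_arg.1 hz).1
  have h3 : (Complex.log z / 2).im = Complex.arg z / 2 := by
    rw [Complex.div_ofNat_im, Complex.log_im]
  rw [h3]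
  constructor <;> linarith

/-- The Dirichlet data `F(0)` of the normalized (`F'(0) = 1`) square-integrable solution of
`-F'' + i x^β F - η F = 0` on `[0,∞)` is a holomorphic function of `η` on `{|η| < c}`. -/
theorem stmt_4 (β : ℝ) (hβ : 0 ≤ β) (c : ℝ) (hc : 0 < c)
    (hspec : ∀ u u' : ℝ → ℂ,
        (∀ x ∈ Ici (0:ℝ), HasDerivWithinAt u (u' x) (Ici 0) x) →
        ContinuousOn u' (Ici 0) →
        IntegrableOn (fun x => ‖u x‖ ^ 2) (Ioi 0) →
        IntegrableOn (fun x => ‖u' x‖ ^ 2) (Ioi 0) →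
        ENNReal.ofReal c * (∫⁻ x in Ioi (0:ℝ), ENNReal.ofReal (‖u x‖ ^ 2)) ≤
          (∫⁻ x in Ioi (0:ℝ), ENNReal.ofReal (‖u' x‖ ^ 2)) +
            ∫⁻ x in Ioi (0:ℝ), ENNReal.ofReal (x ^ β * ‖u x‖ ^ 2)) :
    ∃ Ψ : ℂ → ℂ, DifferentiableOn ℂ Ψ (Metric.ball 0 c) ∧
      ∀ η ∈ Metric.ball (0:ℂ) c,
        ∀ F F' F'' : ℝ → ℂ,
          (∀ x ∈ Ici (0:ℝ), HasDerivWithinAt F (F' x) (Ici 0) x) →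
          (∀ x ∈ Ici (0:ℝ), HasDerivWithinAt F' (F'' x) (Ici 0) x) →
          ContinuousOn F'' (Ici 0) →
          IntegrableOn (fun x => ‖F x‖ ^ 2) (Ioi 0) →
          IntegrableOn (fun x => ‖F' x‖ ^ 2) (Ioi 0) →
          IntegrableOn (fun x => ‖F'' x‖ ^ 2) (Ioi 0) →
          F' 0 = 1 →
          (∀ x : ℝ, 0 ≤ x →
            -F'' x + Complex.I * ((x ^ β : ℝ) : ℂ) * F x - η * F x = 0) →
          F 0 = Ψ η := by
  rcases hβ.eq_or_lt with rfl | hβ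
  · have hc1 := spectral_bound_le_one hspec
    have hmem : ∀ η ∈ Metric.ball (0:ℂ) c, Complex.I - η ∈ Complex.slitPlane := fun η hη =>
      I_sub_mem_slitPlane ((mem_ball_zero_iff.1 hη).trans_le hc1)
    refine ⟨fun η => -(Complex.exp (Complex.log (Complex.I - η) / 2))⁻¹, fun η hη => ?_, ?_⟩
    · exact ((((((differentiableAt_const _).sub differentiableAt_id).clog (hmem η hη)).div_const
        2).cexp).inv (Complex.exp_ne_zero _)).neg.differentiableWithinAt
    · intro η hη F F' F'' hF hF' _ iF iF' _ hF'0 heq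
      set κ := Complex.exp (Complex.log (Complex.I - η) / 2) with hκ
      have hκ2 : κ ^ 2 = Complex.I - η := by
        rw [hκ, ← Complex.exp_nat_mul, Nat.cast_ofNat, mul_div_cancel₀ _ two_ne_zero,
          Complex.exp_log (Complex.slitPlane_ne_zero (hmem η hη))]
      have h := apply_zero_eq_of_sq_re_pos (exp_log_div_two_re_pos (hmem η hη)) hF hF' iF iF'
        fun x hx => by
          have := heq x hx
          rw [Real.rpow_zero, Complex.ofReal_one, mul_one] at this
          rw [← hκ, hκ2]
          linear_combination -this
      rw [hF'0, ← hκ] at h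
      have hκ0 : κ ≠ 0 := Complex.exp_ne_zero _
      change F 0 = -κ⁻¹
      rw [← neg_eq_iff_eq_neg]
      exact eq_inv_of_mul_eq_one_right (by rw [mul_neg, ← h])
  · obtain ⟨Ψ, hΨ, h⟩ := exists_dirichlet_data_of_pos hβ hspec
    exact ⟨Ψ, hΨ, fun η hη F F' F'' hF hF' _ iF iF' _ hF'0 heq =>
      h η hη F F' F'' hF hF' iF iF' hF'0 heq⟩
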